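/- arXiv:2602.03778 — 4 statements merged into one kernel-verified Lean document; each statement's English description precedes it below -/
import Mathlib

section
/- Let T denote the Bäuerle–Ott Bellman operator. For all functions v₁, v₂ : S × ℝ → ℝ and every real C ≥ 0 such that |v₁(s,z) − v₂(s,z)| ≤ C for all (s,z) ∈ S × ℝ, one has |T v₁(s,z) − T v₂(s,z)| ≤ γ·C for all (s,z) ∈ S × ℝ; that is, T is a γ-contraction with respect to the sup-norm. -/
/-- The Bäuerle–Ott Bellman operator:
`T v (s, z) = max_{a ∈ A} γ * Σ_{s'} P(s'|s,a) * v (s', (r s a + z) / γ)`. -/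
noncomputable def bauerleOtt {S A : Type*} [Fintype S] [Fintype A] [Nonempty A]
    (P : S → A → PMF S) (r : S → A → ℝ) (γ : ℝ) (v : S × ℝ → ℝ) : S × ℝ → ℝ :=
  fun x => Finset.univ.sup' Finset.univ_nonempty fun a =>
    γ * ∑ s' : S, ((P x.1 a) s').toReal * v (s', (r x.1 a + x.2) / γ)

/-- The probabilities of a `PMF` on a finite type, read as real numbers, sum to one. -/
theorem PMF.sum_toReal_eq_one {S : Type*} [Fintype S] (p : PMF S) :
    ∑ s : S, (p s).toReal = 1 := by
  rw [← ENNReal.toReal_sum fun s _ => p.apply_ne_top s,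
    ← tsum_fintype (L := .unconditional S), p.tsum_coe, ENNReal.toReal_one]

/-- Monotonicity and discounted shift: `v ≤ w + C` implies `T v ≤ T w + γ * C`. -/
theorem bauerleOtt_le_add {S A : Type*} [Fintype S] [Fintype A] [Nonempty A]
    (P : S → A → PMF S) (r : S → A → ℝ) {γ : ℝ} (hγ : 0 ≤ γ) {v w : S × ℝ → ℝ} {C : ℝ}
    (h : ∀ x, v x ≤ w x + C) (x : S × ℝ) :
    bauerleOtt P r γ v x ≤ bauerleOtt P r γ w x + γ * C := by
  refine Finset.sup'_le _ _ fun a ha => ?_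
  calc γ * ∑ s' : S, ((P x.1 a) s').toReal * v (s', (r x.1 a + x.2) / γ)
      ≤ γ * ∑ s' : S, ((P x.1 a) s').toReal * (w (s', (r x.1 a + x.2) / γ) + C) := by
        gcongr
        exact h _
    _ = γ * ∑ s' : S, ((P x.1 a) s').toReal * w (s', (r x.1 a + x.2) / γ) + γ * C := by
        simp only [mul_add, Finset.sum_add_distrib, ← Finset.sum_mul,
          PMF.sum_toReal_eq_one, one_mul]
    _ ≤ bauerleOtt P r γ w x + γ * C := by
        gcongr
        exact Finset.le_sup' (fun a => γ * ∑ s' : S, ((P x.1 a) s').toReal *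
          w (s', (r x.1 a + x.2) / γ)) ha

/-- the Bäuerle–Ott Bellman operator is a `γ`-contraction in sup-norm. -/
theorem bauerleOtt_contraction {S A : Type*} [Fintype S] [Nonempty S] [Fintype A] [Nonempty A]
    (P : S → A → PMF S) (r : S → A → ℝ) (r_max : ℝ) (hr_max : 0 < r_max)
    (hr : ∀ s a, |r s a| ≤ r_max) (γ : ℝ) (hγ : γ ∈ Set.Ioo (0 : ℝ) 1)
    (v₁ v₂ : S × ℝ → ℝ) (C : ℝ) (hC : 0 ≤ C)
    (h : ∀ s z, |v₁ (s, z) - v₂ (s, z)| ≤ C) :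
    ∀ s z, |bauerleOtt P r γ v₁ (s, z) - bauerleOtt P r γ v₂ (s, z)| ≤ γ * C := by
  intro s z
  have h₁₂ := bauerleOtt_le_add P r hγ.1.le (v := v₁) (w := v₂) (C := C)
    (fun x => by linarith [(abs_le.mp (h x.1 x.2)).2]) (s, z)
  have h₂₁ := bauerleOtt_le_add P r hγ.1.le (v := v₂) (w := v₁) (C := C)
    (fun x => by linarith [(abs_le.mp (h x.1 x.2)).1]) (s, z)
  rw [abs_le]
  constructor <;> linarith
end

section
/- If v : S × ℝ → ℝ is bounded (there exists M with |v(s,z)| ≤ M for all (s,z)) and satisfies T v = v, then v is identically zero. In other words, the zero function is the unique fixed point of the Bäuerle–Ott Bellman operator T in the space of bounded functions on S × ℝ. -/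
/-- The Bäuerle–Ott operator shrinks uniform bounds by the factor `γ`. -/
theorem abs_bauerleOtt_le {S A : Type*} [Fintype S] [Fintype A] [Nonempty A]
    (P : S → A → PMF S) (r : S → A → ℝ) {γ : ℝ} (hγ : 0 ≤ γ) {v : S × ℝ → ℝ} {M : ℝ}
    (hv : ∀ x, |v x| ≤ M) (x : S × ℝ) : |bauerleOtt P r γ v x| ≤ γ * M := by
  obtain ⟨a, -, ha⟩ := Finset.exists_mem_eq_sup' (Finset.univ_nonempty (α := A)) fun a =>
    γ * ∑ s' : S, ((P x.1 a) s').toReal * v (s', (r x.1 a + x.2) / γ)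
  have hsum : ∑ s' : S, ((P x.1 a) s').toReal = 1 := by
    rw [← ENNReal.toReal_sum fun s' _ => (P x.1 a).apply_ne_top s',
      ← tsum_fintype (L := .unconditional S), (P x.1 a).tsum_coe, ENNReal.toReal_one]
  rw [bauerleOtt, ha, abs_mul, abs_of_nonneg hγ]
  refine mul_le_mul_of_nonneg_left ?_ hγ
  calc |∑ s' : S, ((P x.1 a) s').toReal * v (s', (r x.1 a + x.2) / γ)|
      ≤ ∑ s' : S, |((P x.1 a) s').toReal * v (s', (r x.1 a + x.2) / γ)| :=
        Finset.abs_sum_le_sum_abs _ _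
    _ ≤ ∑ s' : S, ((P x.1 a) s').toReal * M := by
        refine Finset.sum_le_sum fun s' _ => ?_
        rw [abs_mul, abs_of_nonneg ENNReal.toReal_nonneg]
        exact mul_le_mul_of_nonneg_left (hv _) ENNReal.toReal_nonneg
    _ = M := by rw [← Finset.sum_mul, hsum, one_mul]

/-- the zero function is the unique bounded fixed point of the
Bäuerle–Ott Bellman operator. -/
theorem bauerleOtt_fixedPoint_zero {S A : Type*} [Fintype S] [Nonempty S] [Fintype A] [Nonempty A]
    (P : S → A → PMF S) (r : S → A → ℝ) (r_max : ℝ) (hr_max : 0 < r_max)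
    (hr : ∀ s a, |r s a| ≤ r_max) (γ : ℝ) (hγ : γ ∈ Set.Ioo (0 : ℝ) 1)
    (v : S × ℝ → ℝ) (hb : ∃ M : ℝ, ∀ s z, |v (s, z)| ≤ M)
    (hfix : bauerleOtt P r γ v = v) :
    ∀ s z, v (s, z) = 0 := by
  obtain ⟨M, hM⟩ := hb
  have hpow : ∀ (n : ℕ) (x : S × ℝ), |v x| ≤ γ ^ n * M := by
    intro n
    induction n with
    | zero => simpa using hM
    | succ n ih =>
      intro x
      have h := abs_bauerleOtt_le P r hγ.1.le ih x
      rwa [hfix, ← mul_assoc, ← pow_succ'] at h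
  have hlim : Filter.Tendsto (fun n : ℕ => γ ^ n * M) Filter.atTop (nhds 0) := by
    simpa using (tendsto_pow_atTop_nhds_zero_of_lt_one hγ.1.le hγ.2).mul_const M
  intro s z
  exact abs_nonpos_iff.mp (ge_of_tendsto' hlim fun n => hpow n (s, z))
end

section
/- Fix s ∈ S and a ∈ A and suppose r(s,a) ≤ 0. Let f : ℝ → ℝ be non-decreasing and let v : S × ℝ → ℝ be non-decreasing in its second argument (z₁ ≤ z₂ implies v(s',z₁) ≤ v(s',z₂) for every s' ∈ S). Then the map z ↦ (min(0, r(s,a)+z) − min(0, z)) + γ · Σ_{s' ∈ S} P(s'|s,a) · v(s', f((r(s,a)+z)/γ)) is non-decreasing on ℝ. -/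
/-- For `c ≤ 0`, the increment of `z ↦ min 0 z` over the step `c` is non-decreasing in `z`. -/
theorem monotone_min_zero_add_sub_min_zero {c : ℝ} (hc : c ≤ 0) :
    Monotone fun z : ℝ => min 0 (c + z) - min 0 z := by
  intro x y hxy
  dsimp only
  grind

/-- with `r s a ≤ 0`, `f` non-decreasing and `v` non-decreasing in its second
argument, the map
`z ↦ (min 0 (r s a + z) - min 0 z) + γ * Σ_{s'} P(s'|s,a) * v (s', f ((r s a + z)/γ))`
is non-decreasing. -/
theorem g_monotone_neg_rewards {S A : Type*} [Fintype S] [Nonempty S] [Fintype A] [Nonempty A]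
    (P : S → A → PMF S) (r : S → A → ℝ) (γ : ℝ) (hγ : γ ∈ Set.Ioo (0 : ℝ) 1)
    (s : S) (a : A) (hr : r s a ≤ 0)
    (f : ℝ → ℝ) (hf : Monotone f)
    (v : S × ℝ → ℝ) (hv : ∀ s' : S, Monotone fun z : ℝ => v (s', z)) :
    Monotone fun z : ℝ =>
      (min 0 (r s a + z) - min 0 z)
        + γ * ∑ s' : S, ((P s a) s').toReal * v (s', f ((r s a + z) / γ)) := by
  intro x y hxy
  refine add_le_add (monotone_min_zero_add_sub_min_zero hr hxy)
    (mul_le_mul_of_nonneg_left (Finset.sum_le_sum fun s' _ => ?_) hγ.1.le)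
  exact mul_le_mul_of_nonneg_left
    (hv s' (hf (div_le_div_of_nonneg_right (add_le_add_right hxy _) hγ.1.le)))
    ENNReal.toReal_nonneg
end

section
/- Assume r(s,a) ≤ 0 for all (s,a). Let l, u : ℝ → ℝ be non-decreasing functions with l(x) ≤ x ≤ u(x) for all x ∈ ℝ, and let v : S × ℝ → ℝ be bounded and non-decreasing in its second argument. Then for every natural number k and every (s,z) ∈ S × ℝ, the k-fold iterates satisfy (T^l)^k v (s,z) ≤ (T^p)^k v (s,z) ≤ (T^u)^k v (s,z). -/
/-- The clamp `p(x) = max (−c) (min x c)`. -/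
noncomputable def clampP (c : ℝ) (x : ℝ) : ℝ := max (-c) (min x c)

/-- The bounding operator `T^e`:
`T^e v (s, z) = max_{a ∈ A} [min 0 (r s a + z) - min 0 z
  + γ * Σ_{s'} P(s'|s,a) * v (s', p (e ((r s a + z) / γ)))]`,
where `p` is the clamp to `[-rγ, rγ]`. `T^p` is the case `e = id`. -/
noncomputable def Te {S A : Type*} [Fintype S] [Fintype A] [Nonempty A]
    (P : S → A → PMF S) (r : S → A → ℝ) (γ rγ : ℝ) (e : ℝ → ℝ)
    (v : S × ℝ → ℝ) : S × ℝ → ℝ :=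
  fun x => Finset.univ.sup' Finset.univ_nonempty fun a =>
    min 0 (r x.1 a + x.2) - min 0 x.2
      + γ * ∑ s' : S, ((P x.1 a) s').toReal *
          v (s', clampP rγ (e ((r x.1 a + x.2) / γ)))

theorem clampP_monotone (c : ℝ) : Monotone (clampP c) := fun _ _ h =>
  max_le_max le_rfl (min_le_min h le_rfl)

/-- If `v (s, z) ≤ w (s, z')` and `e z ≤ e' z'` whenever `z ≤ z'`, then `T^e v` and `T^e' w` are
related in the same way. -/
theorem Te_le_Te {S A : Type*} [Fintype S] [Fintype A] [Nonempty A]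
    (P : S → A → PMF S) {r : S → A → ℝ} (hr : ∀ s a, r s a ≤ 0) {γ : ℝ} (hγ : 0 ≤ γ) (rγ : ℝ)
    {e e' : ℝ → ℝ} (he : ∀ x y, x ≤ y → e x ≤ e' y) {v w : S × ℝ → ℝ}
    (hvw : ∀ s z z', z ≤ z' → v (s, z) ≤ w (s, z')) (s : S) (z z' : ℝ) (hz : z ≤ z') :
    Te P r γ rγ e v (s, z) ≤ Te P r γ rγ e' w (s, z') := by
  refine Finset.sup'_mono_fun fun a _ => add_le_add ?_ ?_
  · exact monotone_min_zero_add_sub_min_zero (hr s a) hz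
  · refine mul_le_mul_of_nonneg_left (Finset.sum_le_sum fun s' _ => ?_) hγ
    refine mul_le_mul_of_nonneg_left (hvw _ _ _ (clampP_monotone _ (he _ _ ?_)))
      ENNReal.toReal_nonneg
    exact div_le_div_of_nonneg_right (add_le_add_right hz _) hγ

theorem Te_iterate_le_Te_iterate {S A : Type*} [Fintype S] [Fintype A] [Nonempty A]
    (P : S → A → PMF S) {r : S → A → ℝ} (hr : ∀ s a, r s a ≤ 0) {γ : ℝ} (hγ : 0 ≤ γ) (rγ : ℝ)
    {e e' : ℝ → ℝ} (he : ∀ x y, x ≤ y → e x ≤ e' y) {v : S × ℝ → ℝ}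
    (hv : ∀ s : S, Monotone fun z : ℝ => v (s, z)) (k : ℕ) :
    ∀ s z z', z ≤ z' → (Te P r γ rγ e)^[k] v (s, z) ≤ (Te P r γ rγ e')^[k] v (s, z') := by
  induction k with
  | zero => exact fun s _ _ h => hv s h
  | succ k ih =>
    simp only [Function.iterate_succ_apply']
    exact Te_le_Te P hr hγ rγ he ih

/-- with non-positive rewards, non-decreasing envelopes `l ≤ id ≤ u`, and a
bounded value function `v` non-decreasing in `z`, the `k`-fold iterates satisfy
`(T^l)^k v ≤ (T^p)^k v ≤ (T^u)^k v` pointwise. -/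
theorem iterates_ordering {S A : Type*} [Fintype S] [Nonempty S] [Fintype A] [Nonempty A]
    (P : S → A → PMF S) (r : S → A → ℝ) (r_max : ℝ) (hr_max : 0 < r_max)
    (hr : ∀ s a, |r s a| ≤ r_max) (γ : ℝ) (hγ : γ ∈ Set.Ioo (0 : ℝ) 1)
    (hr_nonpos : ∀ s a, r s a ≤ 0)
    (l u : ℝ → ℝ) (hl : Monotone l) (hu : Monotone u)
    (hlu : ∀ x : ℝ, l x ≤ x ∧ x ≤ u x)
    (v : S × ℝ → ℝ) (hb : ∃ M : ℝ, ∀ s z, |v (s, z)| ≤ M)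
    (hmono : ∀ s : S, Monotone fun z : ℝ => v (s, z)) :
    ∀ k : ℕ, ∀ s z,
      (Te P r γ (r_max / (1 - γ)) l)^[k] v (s, z)
          ≤ (Te P r γ (r_max / (1 - γ)) id)^[k] v (s, z) ∧
      (Te P r γ (r_max / (1 - γ)) id)^[k] v (s, z)
          ≤ (Te P r γ (r_max / (1 - γ)) u)^[k] v (s, z) := by
  intro k s z
  exact ⟨Te_iterate_le_Te_iterate P hr_nonpos hγ.1.le _ (fun x y h => (hlu x).1.trans h)
      hmono k s z z le_rfl,
    Te_iterate_le_Te_iterate P hr_nonpos hγ.1.le _ (fun x y h => h.trans (hlu y).2)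
      hmono k s z z le_rfl⟩
end
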